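/- (Independence of the simplicial complement) Let K be a simplicial complex on [m] and let ℙ, ℙ' be two simplicial complements of K. Then for every i and every J ⊆ [m], H_i(Λ^{*,J}[ℙ], d) ≅ H_i(Λ^{*,J}[ℙ'], d). -/

import Mathlib

open Classical
noncomputable section

/-- Homology of a `ℤ`-indexed chain complex whose differential lowers degree by one:
`H_q = ker d_q / (image of d_{q+1} intersected with the kernel)`. -/
abbrev homologyDown (k : Type*) [CommRing k] (C : ℤ → Type*)
    [∀ q, AddCommGroup (C q)] [∀ q, Module k (C q)]
    (d : ∀ q : ℤ, C q →ₗ[k] C (q - 1)) (q : ℤ) : Type _ :=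
  LinearMap.ker (d q) ⧸ Submodule.span k
    {x : LinearMap.ker (d q) | ∃ p : ℤ, ∃ h : p - 1 = q, ∃ y : C p, h ▸ d p y = (x : C q)}

/-- Cohomology of a `ℤ`-indexed cochain complex whose differential raises degree by one. -/
abbrev homologyUp (k : Type*) [CommRing k] (C : ℤ → Type*)
    [∀ q, AddCommGroup (C q)] [∀ q, Module k (C q)]
    (d : ∀ q : ℤ, C q →ₗ[k] C (q + 1)) (q : ℤ) : Type _ :=
  LinearMap.ker (d q) ⧸ Submodule.span k
    {x : LinearMap.ker (d q) | ∃ p : ℤ, ∃ h : p + 1 = q, ∃ y : C p, h ▸ d p y = (x : C q)}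

/-- `K` is an (abstract) simplicial complex: closed under taking subsets. -/
def IsComplex {m : ℕ} (K : Set (Finset (Fin m))) : Prop :=
  ∀ σ ∈ K, ∀ τ, τ ⊆ σ → τ ∈ K

/-- `τ` is a missing face of `K`. -/
def MissingFace {m : ℕ} (K : Set (Finset (Fin m))) (τ : Finset (Fin m)) : Prop :=
  τ ∉ K ∧ ∀ σ, σ ⊂ τ → σ ∈ K

/-- `P` is a simplicial complement of `K`: a set of non-faces containing all missing faces. -/
def IsSimplicialComplement {m : ℕ} (K P : Set (Finset (Fin m))) : Prop :=
  (∀ τ ∈ P, τ ∉ K) ∧ ∀ τ, MissingFace K τ → τ ∈ P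

variable (k : Type*) [CommRing k]

/-- An injective rank function on `Finset (Fin m)`, used to order exterior-algebra generators. -/
def ordF {m : ℕ} (s : Finset (Fin m)) : ℕ := ∑ i ∈ s, 2 ^ (i : ℕ)

/-- Basis monomials of `Λ^{q,J}[P]`: squarefree exterior monomials in the elements of `P`
(i.e. subsets `S ⊆ P`) of length `q` and total set `J`. -/
def LMon {m : ℕ} (P : Set (Finset (Fin m))) (J : Finset (Fin m)) (q : ℤ) : Type :=
  {S : Finset (Finset (Fin m)) // ↑S ⊆ P ∧ (S.card : ℤ) = q ∧ S.sup id = J}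

/-- The degree-`q` component of the chain complex `Λ^{*,J}[P]`. -/
def LC {m : ℕ} (P : Set (Finset (Fin m))) (J : Finset (Fin m)) (q : ℤ) : Type _ :=
  LMon P J q →₀ k

instance {m : ℕ} (P : Set (Finset (Fin m))) (J : Finset (Fin m)) (q : ℤ) :
    AddCommGroup (LC k P J q) := Finsupp.instAddCommGroup
instance {m : ℕ} (P : Set (Finset (Fin m))) (J : Finset (Fin m)) (q : ℤ) :
    Module k (LC k P J q) := Finsupp.module _ _

/-- The differential of `Λ^{*,J}[P]`: delete one factor at a time, with alternating signs,
keeping only the terms whose total set is still `J`. -/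
def dL {m : ℕ} (P : Set (Finset (Fin m))) (J : Finset (Fin m)) (q : ℤ) :
    LC k P J q →ₗ[k] LC k P J (q - 1) :=
  Finsupp.lift _ k _ fun S =>
    ∑ τ ∈ S.1.attach,
      if h : (S.1.erase τ.1).sup id = J then
        ((-1 : k) ^ ((S.1.filter (fun σ => ordF σ < ordF τ.1)).card)) •
          Finsupp.single
            ⟨S.1.erase τ.1,
              ⟨fun σ hσ => S.2.1 (Finset.erase_subset _ _ hσ),
               by
                 have h1 : 1 ≤ S.1.card := Finset.card_pos.mpr ⟨τ.1, τ.2⟩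
                 have h2 := S.2.2.1
                 rw [Finset.card_erase_of_mem τ.2]
                 push_cast [h1]
                 omega,
               h⟩⟩ 1
      else 0

/-- Homology of the chain complex `Λ^{*,J}[P]`. -/
abbrev HL {m : ℕ} (P : Set (Finset (Fin m))) (J : Finset (Fin m)) (i : ℤ) : Type _ :=
  homologyDown k (LC k P J) (dL k P J) i


theorem ordF_injective {m : ℕ} : Function.Injective (ordF : Finset (Fin m) → ℕ) := by
  intro s t h
  have h2 : (s.map Fin.valEmbedding) = (t.map Fin.valEmbedding) := by
    apply Finset.geomSum_injective (le_refl 2)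
    simpa [ordF] using h
  exact Finset.map_injective _ h2

/-- sign of `x` in `S` -/
def sgF {m : ℕ} (x : Finset (Fin m)) (S : Finset (Finset (Fin m))) : k :=
  (-1 : k) ^ ((S.filter (fun σ => ordF σ < ordF x)).card)

theorem sgF_erase_lt {m : ℕ} {x y : Finset (Fin m)} {S : Finset (Finset (Fin m))}
    (hy : y ∈ S) (h : ordF y < ordF x) : sgF k x (S.erase y) = - sgF k x S := by
  unfold sgF
  have : S.filter (fun σ => ordF σ < ordF x) =
      insert y ((S.erase y).filter (fun σ => ordF σ < ordF x)) := by
    ext z; simp only [Finset.mem_filter, Finset.mem_insert, Finset.mem_erase]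
    grind
  rw [this, Finset.card_insert_of_notMem (by simp), pow_succ]
  ring

theorem sgF_erase_not_lt {m : ℕ} {x y : Finset (Fin m)} {S : Finset (Finset (Fin m))}
    (h : ¬ ordF y < ordF x) : sgF k x (S.erase y) = sgF k x S := by
  unfold sgF
  congr 2
  ext z; simp only [Finset.mem_filter, Finset.mem_erase]
  grind

theorem sgF_sq {m : ℕ} (x : Finset (Fin m)) (S : Finset (Finset (Fin m))) :
    sgF k x S * sgF k x S = 1 := by
  unfold sgF
  rw [← pow_add, ← two_mul, pow_mul]; simp

/-- anticommutation of signs -/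
theorem sgF_swap {m : ℕ} {x y : Finset (Fin m)} {S : Finset (Finset (Fin m))}
    (hx : x ∈ S) (hy : y ∈ S) (hne : x ≠ y) :
    sgF k x S * sgF k y (S.erase x) = - (sgF k y S * sgF k x (S.erase y)) := by
  have : ordF x ≠ ordF y := fun h => hne (ordF_injective h)
  rcases lt_or_gt_of_ne this with h | h
  · rw [sgF_erase_lt k hx h, sgF_erase_not_lt k (not_lt.mpr h.le)]; ring
  · rw [sgF_erase_lt k hy h, sgF_erase_not_lt k (not_lt.mpr h.le)]; ring

/-- ambient module -/
abbrev VF (m : ℕ) : Type _ := Finset (Finset (Fin m)) →₀ k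

/-- value of the ambient differential on a monomial -/
def DF0 {m : ℕ} (J : Finset (Fin m)) (S : Finset (Finset (Fin m))) : VF k m :=
  ∑ x ∈ S, if (S.erase x).sup id = J then Finsupp.single (S.erase x) (sgF k x S) else 0

/-- ambient differential -/
def DF {m : ℕ} (J : Finset (Fin m)) : VF k m →ₗ[k] VF k m :=
  Finsupp.lift _ k _ (DF0 k J)

theorem DF_single {m : ℕ} (J : Finset (Fin m)) (S : Finset (Finset (Fin m))) (c : k) :
    DF k J (Finsupp.single S c) = c • DF0 k J S := by
  simp [DF]

/-- value of the homotopy on a monomial -/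
def HF0 {m : ℕ} (σ τ : Finset (Fin m)) (S : Finset (Finset (Fin m))) : VF k m :=
  if σ ∈ S ∧ τ ∉ S then Finsupp.single (insert τ S) (sgF k τ S) else 0

/-- homotopy -/
def HF {m : ℕ} (σ τ : Finset (Fin m)) : VF k m →ₗ[k] VF k m :=
  Finsupp.lift _ k _ (HF0 k σ τ)

theorem HF_single {m : ℕ} (σ τ : Finset (Fin m)) (S : Finset (Finset (Fin m))) (c : k) :
    HF k σ τ (Finsupp.single S c) = c • HF0 k σ τ S := by
  simp [HF]

theorem DF_DF0 {m : ℕ} (J : Finset (Fin m)) (S : Finset (Finset (Fin m)))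
    (hS : S.sup id = J) : DF k J (DF0 k J S) = 0 := by
  have key : DF k J (DF0 k J S) = ∑ p ∈ S.sigma (fun x => S.erase x),
      if ((S.erase p.1).erase p.2).sup id = J then
        Finsupp.single ((S.erase p.1).erase p.2) (sgF k p.1 S * sgF k p.2 (S.erase p.1))
      else 0 := by
    rw [DF0, map_sum, Finset.sum_sigma]
    refine Finset.sum_congr rfl fun x hx => ?_
    split_ifs with h
    · rw [DF_single, DF0, Finset.smul_sum]
      refine Finset.sum_congr rfl fun y hy => ?_
      split_ifs <;> simp
    · rw [map_zero]
      refine (Finset.sum_eq_zero fun y hy => ?_).symm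
      rw [if_neg]
      intro h2
      apply h
      apply le_antisymm
      · rw [← hS]; exact Finset.sup_mono (Finset.erase_subset _ _)
      · rw [← h2]; exact Finset.sup_mono (Finset.erase_subset _ _)
  rw [key]
  refine Finset.sum_involution (fun p _ => ⟨p.2, p.1⟩) ?_ ?_ ?_ ?_
  · rintro ⟨x, y⟩ h
    simp only [Finset.mem_sigma, Finset.mem_erase] at h
    simp only [Finset.erase_right_comm (a := y) (b := x)]
    split_ifs
    · rw [← Finsupp.single_add, sgF_swap k h.1 h.2.2 (Ne.symm h.2.1)]; simp
    · simp
  · rintro ⟨x, y⟩ h _ he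
    simp only [Finset.mem_sigma, Finset.mem_erase] at h
    simp only [Sigma.mk.injEq] at he
    exact h.2.1 he.1
  · rintro ⟨x, y⟩ h
    simp only [Finset.mem_sigma, Finset.mem_erase] at h ⊢
    exact ⟨h.2.2, Ne.symm h.2.1, h.1⟩
  · rintro ⟨x, y⟩ h
    rfl

/-- monomials of the given type -/
def monF {m : ℕ} (P : Set (Finset (Fin m))) (J : Finset (Fin m)) (q : ℤ) :
    Set (Finset (Finset (Fin m))) :=
  {S | ↑S ⊆ P ∧ (S.card : ℤ) = q ∧ S.sup id = J}

/-- chains of the given type -/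
abbrev AF {m : ℕ} (P : Set (Finset (Fin m))) (J : Finset (Fin m)) (q : ℤ) :
    Submodule k (VF k m) := Finsupp.supported k k (monF P J q)

theorem AF_induct {m : ℕ} {P : Set (Finset (Fin m))} {J : Finset (Fin m)} {q : ℤ}
    (N : Submodule k (VF k m)) (f : VF k m →ₗ[k] VF k m)
    (h : ∀ S ∈ monF P J q, f (Finsupp.single S 1) ∈ N) {x : VF k m} (hx : x ∈ AF k P J q) :
    f x ∈ N := by
  have : AF k P J q ≤ N.comap f := by
    rw [AF, Finsupp.supported_eq_span_single, Submodule.span_le]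
    rintro _ ⟨S, hS, rfl⟩
    exact h S hS
  exact this hx

theorem DF_sq {m : ℕ} {P : Set (Finset (Fin m))} {J : Finset (Fin m)} {q : ℤ}
    {x : VF k m} (hx : x ∈ AF k P J q) : DF k J (DF k J x) = 0 := by
  have := AF_induct k ⊥ (DF k J ∘ₗ DF k J) (fun S hS => ?_) hx
  · simpa using this
  · simp [DF_single, DF_DF0 k J S hS.2.2]

theorem HF_mem {m : ℕ} {P : Set (Finset (Fin m))} {J : Finset (Fin m)} {q : ℤ}
    {σ τ : Finset (Fin m)} (hτ : τ ∈ P) (hστ : τ ⊆ σ)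
    {x : VF k m} (hx : x ∈ AF k P J q) : HF k σ τ x ∈ AF k P J (q + 1) := by
  refine AF_induct k _ _ (fun S hS => ?_) hx
  rw [HF_single, one_smul, HF0]
  split_ifs with h
  · apply Finsupp.single_mem_supported
    refine ⟨?_, ?_, ?_⟩
    · rw [Finset.coe_insert]; exact Set.insert_subset hτ hS.1
    · rw [Finset.card_insert_of_notMem h.2]; push_cast; rw [hS.2.1]
    · rw [Finset.sup_insert, hS.2.2, sup_eq_right, ← hS.2.2]
      exact le_trans hστ (Finset.le_sup (f := id) h.1)
  · exact zero_mem _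

theorem HF_zero {m : ℕ} {P : Set (Finset (Fin m))} {J : Finset (Fin m)} {q : ℤ}
    {σ τ : Finset (Fin m)} (hσ : σ ∉ P)
    {x : VF k m} (hx : x ∈ AF k P J q) : HF k σ τ x = 0 := by
  have := AF_induct k ⊥ (HF k σ τ) (fun S hS => ?_) hx
  · simpa using this
  · rw [HF_single, one_smul, HF0, if_neg]
    · exact zero_mem _
    · exact fun h => hσ (hS.1 h.1)

theorem DF_mem {m : ℕ} {P : Set (Finset (Fin m))} {J : Finset (Fin m)} {q : ℤ}
    {x : VF k m} (hx : x ∈ AF k P J q) : DF k J x ∈ AF k P J (q - 1) := by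
  refine AF_induct k _ _ (fun S hS => ?_) hx
  rw [DF_single, one_smul, DF0]
  refine sum_mem fun x hx => ?_
  split_ifs with h
  · apply Finsupp.single_mem_supported
    refine ⟨?_, ?_, h⟩
    · exact fun z hz => hS.1 (Finset.erase_subset _ _ hz)
    · have h1 : 1 ≤ S.card := Finset.card_pos.mpr ⟨x, hx⟩
      have h2 := hS.2.1
      rw [Finset.card_erase_of_mem hx]
      push_cast [h1]
      omega
  · exact zero_mem _

/-- chains without `σ` -/
abbrev NF {m : ℕ} (σ : Finset (Fin m)) : Submodule k (VF k m) :=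
  Finsupp.supported k k {S | σ ∉ S}

theorem homotopy_mono {m : ℕ} {J : Finset (Fin m)} {σ τ : Finset (Fin m)} (hστ : τ ⊂ σ)
    (S : Finset (Finset (Fin m))) (hS : S.sup id = J) :
    Finsupp.single S 1 - DF k J (HF0 k σ τ S) - HF k σ τ (DF0 k J S) ∈ NF k σ := by
  have hne : σ ≠ τ := hστ.ne'
  by_cases hσ : σ ∈ S
  swap
  · have h1 : HF0 k σ τ S = 0 := by rw [HF0, if_neg]; tauto
    have h2 : HF k σ τ (DF0 k J S) = 0 := by
      rw [DF0, map_sum]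
      refine Finset.sum_eq_zero fun x hx => ?_
      split_ifs
      · rw [HF_single, HF0, if_neg, smul_zero]
        simp [hσ]
      · simp
    rw [h1, h2, map_zero, sub_zero, sub_zero]
    exact Finsupp.single_mem_supported k _ hσ
  have hsup : ∀ T : Finset (Finset (Fin m)), σ ∈ T → (insert τ T).sup id = T.sup id := by
    intro T hT
    rw [Finset.sup_insert, sup_eq_right]
    exact le_trans hστ.1 (Finset.le_sup (f := id) hT)
  by_cases hτ : τ ∈ S
  · have h1 : HF0 k σ τ S = 0 := by rw [HF0, if_neg]; tauto
    have h2 : HF k σ τ (DF0 k J S) = Finsupp.single S 1 := by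
      rw [DF0, map_sum, Finset.sum_eq_single τ]
      · have hm : σ ∈ S.erase τ := Finset.mem_erase.mpr ⟨hne, hσ⟩
        have h3 := hsup (S.erase τ) hm
        rw [Finset.insert_erase hτ] at h3
        rw [if_pos (by rw [← h3, hS]), HF_single, HF0, if_pos ⟨hm, by simp⟩,
          Finset.insert_erase hτ, sgF_erase_not_lt k (lt_irrefl _)]
        simp [sgF_sq]
      · intro x hx hxτ
        split_ifs
        · rw [HF_single, HF0, if_neg, smul_zero]
          simp [hτ, Ne.symm hxτ]
        · simp
      · exact fun h => absurd hτ h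
    rw [h1, h2, map_zero, sub_zero, sub_self]
    exact zero_mem _
  · have hσi : σ ∈ insert τ S := Finset.mem_insert_of_mem hσ
    have hsgT : sgF k τ (insert τ S) = sgF k τ S := by
      rw [← sgF_erase_not_lt k (y := τ) (lt_irrefl _), Finset.erase_insert hτ]
    have h1 : DF k J (HF0 k σ τ S) = Finsupp.single S 1 + ∑ x ∈ S,
        if ((insert τ S).erase x).sup id = J then
          Finsupp.single ((insert τ S).erase x) (sgF k τ S * sgF k x (insert τ S)) else 0 := by
      rw [HF0, if_pos ⟨hσ, hτ⟩, DF_single, DF0, Finset.sum_insert hτ, smul_add,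
        Finset.erase_insert hτ, if_pos hS, hsgT]
      congr 1
      · simp [sgF_sq]
      · rw [Finset.smul_sum]
        refine Finset.sum_congr rfl fun x hx => ?_
        split_ifs <;> simp
    have h2 : HF k σ τ (DF0 k J S) = ∑ x ∈ S,
        if (S.erase x).sup id = J then sgF k x S • HF0 k σ τ (S.erase x) else 0 := by
      rw [DF0, map_sum]
      refine Finset.sum_congr rfl fun x hx => ?_
      split_ifs
      · rw [HF_single]
      · simp
    rw [h1, h2, sub_add_eq_sub_sub, sub_self, zero_sub, ← neg_add', ← Finset.sum_add_distrib]
    refine neg_mem (sum_mem fun x hx => ?_)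
    have hxτ : x ≠ τ := fun h => hτ (h ▸ hx)
    by_cases hxσ : x = σ
    · subst hxσ
      refine add_mem ?_ ?_
      · split_ifs
        · apply Finsupp.single_mem_supported
          simp
        · exact zero_mem _
      · have h0 : HF0 k x τ (S.erase x) = 0 := by
          rw [HF0, if_neg]
          simp
        rw [h0, smul_zero, ite_self]
        exact zero_mem _
    · have hm : σ ∈ S.erase x := Finset.mem_erase.mpr ⟨Ne.symm hxσ, hσ⟩
      have he : (insert τ S).erase x = insert τ (S.erase x) :=
        Finset.erase_insert_of_ne (Ne.symm hxτ)
      rw [he, hsup _ hm]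
      convert zero_mem (NF k σ)
      split_ifs
      · have hw := sgF_swap k (S := insert τ S) (Finset.mem_insert_of_mem hx)
          (Finset.mem_insert_self τ S) hxτ
        rw [Finset.erase_insert hτ, hsgT, he] at hw
        have hsgT2 : sgF k τ (insert τ (S.erase x)) = sgF k τ (S.erase x) := by
          rw [← sgF_erase_not_lt k (y := τ) (S := insert τ (S.erase x)) (lt_irrefl _),
            Finset.erase_insert (by simp [hτ])]
        rw [hsgT2] at hw
        have hsq := sgF_sq k τ S
        have hsq2 := sgF_sq k τ (S.erase x)
        rw [HF0, if_pos ⟨hm, by simp [hτ]⟩, Finsupp.smul_single, ← Finsupp.single_add]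
        have : sgF k τ S * sgF k x (insert τ S) + sgF k x S • sgF k τ (S.erase x) = 0 := by
          rw [smul_eq_mul]
          linear_combination (sgF k τ S * sgF k τ (S.erase x)) * hw +
            (- sgF k τ S * sgF k x (insert τ S)) * hsq2 
            - (sgF k x S * sgF k τ (S.erase x)) * hsq 
        rw [this, Finsupp.single_zero]
      · simp

theorem homotopy_mem {m : ℕ} {P : Set (Finset (Fin m))} {J : Finset (Fin m)} {q : ℤ}
    {σ τ : Finset (Fin m)} (hτ : τ ∈ P) (hστ : τ ⊂ σ)
    {x : VF k m} (hx : x ∈ AF k (insert σ P) J q) :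
    x - DF k J (HF k σ τ x) - HF k σ τ (DF k J x) ∈ AF k P J q := by
  have h1 : x - DF k J (HF k σ τ x) - HF k σ τ (DF k J x) ∈ NF k σ := by
    have := AF_induct k (NF k σ)
      (LinearMap.id - DF k J ∘ₗ HF k σ τ - HF k σ τ ∘ₗ DF k J) (fun S hS => ?_) hx
    · simpa using this
    · simpa [HF_single, DF_single] using homotopy_mono k hστ S hS.2.2
  have hτ' : τ ∈ insert σ P := Set.mem_insert_of_mem _ hτ
  have h2 : x - DF k J (HF k σ τ x) - HF k σ τ (DF k J x) ∈ AF k (insert σ P) J q := by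
    have a := DF_mem k (HF_mem k hτ' hστ.1 hx)
    have b := HF_mem k hτ' hστ.1 (DF_mem k hx)
    rw [add_sub_cancel_right] at a
    rw [sub_add_cancel] at b
    exact sub_mem (sub_mem hx a) b
  have h3 : _ ∈ NF k σ ⊓ AF k (insert σ P) J q := ⟨h1, h2⟩
  rw [← Finsupp.supported_inter] at h3
  refine Finsupp.supported_mono ?_ h3
  rintro S ⟨hs, hS⟩
  refine ⟨fun z hz => ?_, hS.2⟩
  rcases hS.1 hz with rfl | h
  · exact absurd hz hs
  · exact h

/-- embedding in the ambient module -/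
def EF {m : ℕ} (P : Set (Finset (Fin m))) (J : Finset (Fin m)) (q : ℤ) :
    LC k P J q →ₗ[k] VF k m :=
  Finsupp.lmapDomain k k (fun S : LMon P J q => S.1)

theorem EF_inj {m : ℕ} (P : Set (Finset (Fin m))) (J : Finset (Fin m)) (q : ℤ) :
    Function.Injective (EF k P J q) :=
  Finsupp.mapDomain_injective Subtype.val_injective

theorem EF_range {m : ℕ} (P : Set (Finset (Fin m))) (J : Finset (Fin m)) (q : ℤ) :
    LinearMap.range (EF k P J q) = AF k P J q := by
  unfold EF
  erw [Finsupp.range_lmapDomain]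
  rw [AF, Finsupp.supported_eq_span_single]
  congr 1
  ext v
  constructor
  · rintro ⟨S, rfl⟩
    exact ⟨S.1, S.2, rfl⟩
  · rintro ⟨S, hS, rfl⟩
    exact ⟨⟨S, hS⟩, rfl⟩

theorem EF_dL {m : ℕ} (P : Set (Finset (Fin m))) (J : Finset (Fin m)) (q : ℤ)
    (x : LC k P J q) : EF k P J (q - 1) (dL k P J q x) = DF k J (EF k P J q x) := by
  suffices h : EF k P J (q - 1) ∘ₗ dL k P J q = DF k J ∘ₗ EF k P J q from
    LinearMap.congr_fun h x
  refine Finsupp.lhom_ext' fun S => LinearMap.ext_ring ?_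
  have e1 : EF k P J q (Finsupp.single S 1) = Finsupp.single S.1 1 :=
    Finsupp.mapDomain_single
  have e2 : DF k J (EF k P J q (Finsupp.single S 1)) = DF0 k J S.1 := by
    rw [e1, DF_single, one_smul]
  refine Eq.trans ?_ e2.symm
  rw [DF0, ← Finset.sum_attach]
  have e3 : dL k P J q (Finsupp.single S 1) = _ := 
    (Finsupp.sum_single_index (by simp)).trans (one_smul _ _)
  refine (congrArg (EF k P J (q - 1)) e3).trans ?_
  rw [map_sum]
  refine Finset.sum_congr rfl fun τ _ => ?_
  by_cases h : (S.1.erase τ.1).sup id = J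
  · rw [if_pos h]
    refine (congrArg (EF k P J (q - 1)) (dif_pos h)).trans ?_
    refine (map_smul (EF k P J (q - 1)) _ _).trans ?_
    refine (congrArg _ Finsupp.mapDomain_single).trans ?_
    rw [Finsupp.smul_single, smul_eq_mul, mul_one]
    rfl
  · rw [if_neg h]
    exact (congrArg (EF k P J (q - 1)) (dif_neg h)).trans (map_zero _)

theorem EF_cast {m : ℕ} (P : Set (Finset (Fin m))) (J : Finset (Fin m)) {p q : ℤ}
    (h : p = q) (x : LC k P J p) : EF k P J q (h ▸ x) = EF k P J p x := by
  subst h; rfl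

theorem mem_ker_iff {m : ℕ} (P : Set (Finset (Fin m))) (J : Finset (Fin m)) (q : ℤ)
    (x : LC k P J q) : x ∈ LinearMap.ker (dL k P J q) ↔ DF k J (EF k P J q x) = 0 := by
  rw [LinearMap.mem_ker, ← EF_dL, map_eq_zero_iff _ (EF_inj k P J (q - 1))]

/-- the boundaries in the definition of `HL` -/
abbrev BF {m : ℕ} (P : Set (Finset (Fin m))) (J : Finset (Fin m)) (q : ℤ) :
    Submodule k (LinearMap.ker (dL k P J q)) :=
  Submodule.span k
    {x : LinearMap.ker (dL k P J q) | ∃ p : ℤ, ∃ h : p - 1 = q, ∃ y : LC k P J p,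
      h ▸ dL k P J p y = (x : LC k P J q)}

theorem mem_BF_iff {m : ℕ} (P : Set (Finset (Fin m))) (J : Finset (Fin m)) (q : ℤ)
    (x : LinearMap.ker (dL k P J q)) :
    x ∈ BF k P J q ↔ ∃ y ∈ AF k P J (q + 1), DF k J y = EF k P J q x.1 := by
  constructor
  · intro hx
    have : BF k P J q ≤ ((AF k P J (q + 1)).map (DF k J)).comap
        (EF k P J q ∘ₗ (LinearMap.ker (dL k P J q)).subtype) := by
      refine Submodule.span_le.mpr ?_
      rintro x ⟨p, h, y, hy⟩
      refine ⟨EF k P J p y, ?_, ?_⟩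
      · have hp : p = q + 1 := by omega
        rw [← hp, SetLike.mem_coe, ← EF_range]
        exact ⟨y, rfl⟩
      · simp only [LinearMap.comp_apply, Submodule.subtype_apply]
        rw [← hy, EF_cast, EF_dL]
    exact this hx
  · rintro ⟨y, hy, h⟩
    rw [← EF_range] at hy
    obtain ⟨y, rfl⟩ := hy
    refine Submodule.subset_span ⟨q + 1, by omega, y, ?_⟩
    apply EF_inj k P J q
    rw [EF_cast, EF_dL, h]

theorem HL_step {m : ℕ} (P : Set (Finset (Fin m))) (J : Finset (Fin m)) (q : ℤ)
    {σ τ : Finset (Fin m)} (hτ : τ ∈ P) (hστ : τ ⊂ σ) (hσ : σ ∉ P) :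
    Nonempty (HL k P J q ≃ₗ[k] HL k (insert σ P) J q) := by
  have hle : ∀ q, AF k P J q ≤ AF k (insert σ P) J q := fun q =>
    Finsupp.supported_mono fun S hS => ⟨hS.1.trans (Set.subset_insert _ _), hS.2⟩
  let ι : LC k P J q →ₗ[k] LC k (insert σ P) J q :=
    Finsupp.lmapDomain k k
      (fun S : LMon P J q => (⟨S.1, S.2.1.trans (Set.subset_insert _ _), S.2.2⟩ :
        LMon (insert σ P) J q))
  have hι : ∀ x, EF k (insert σ P) J q (ι x) = EF k P J q x := fun x =>
    (Finsupp.mapDomain_comp (f := (fun S : LMon P J q =>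
      (⟨S.1, S.2.1.trans (Set.subset_insert _ _), S.2.2⟩ : LMon (insert σ P) J q)))
      (g := fun S => S.1)).symm
  let f : LinearMap.ker (dL k P J q) →ₗ[k] LinearMap.ker (dL k (insert σ P) J q) :=
    ι.restrict (fun x hx => by
      rw [mem_ker_iff] at hx ⊢
      rw [hι, hx])
  have hf : ∀ x, EF k (insert σ P) J q (f x).1 = EF k P J q x.1 := fun x => hι x.1
  have hB : BF k P J q = (BF k (insert σ P) J q).comap f := by
    ext x
    rw [Submodule.mem_comap, mem_BF_iff, mem_BF_iff, hf]
    constructor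
    · rintro ⟨y, hy, h⟩
      exact ⟨y, hle _ hy, h⟩
    · rintro ⟨y, hy, h⟩
      refine ⟨_, homotopy_mem k hτ hστ hy, ?_⟩
      have hx : EF k P J q x.1 ∈ AF k P J q := by rw [← EF_range]; exact ⟨_, rfl⟩
      rw [h, HF_zero k hσ hx, sub_zero, map_sub,
        DF_sq k (HF_mem k (Set.mem_insert_of_mem _ hτ) hστ.1 hy), sub_zero, h]
  refine ⟨LinearEquiv.ofBijective (Submodule.mapQ (BF k P J q) (BF k (insert σ P) J q) f hB.le)
    ⟨?_, ?_⟩⟩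
  · rw [← LinearMap.ker_eq_bot, Submodule.ker_mapQ, ← hB]
    simp
  · intro z
    obtain ⟨x, rfl⟩ := Submodule.Quotient.mk_surjective _ z
    have hx : EF k (insert σ P) J q x.1 ∈ AF k (insert σ P) J q := by
      rw [← EF_range]; exact ⟨_, rfl⟩
    have hx0 := (mem_ker_iff k _ _ _ _).mp x.2
    have hr := homotopy_mem k hτ hστ hx
    have hh := HF_mem k (Set.mem_insert_of_mem σ hτ) hστ.1 hx
    rw [hx0, map_zero, sub_zero, ← EF_range] at hr
    obtain ⟨y, hy⟩ := hr
    have hyk : y ∈ LinearMap.ker (dL k P J q) := by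
      rw [mem_ker_iff, hy, map_sub, hx0, DF_sq k hh, sub_zero]
    refine ⟨Submodule.Quotient.mk ⟨y, hyk⟩, ?_⟩
    rw [Submodule.mapQ_apply, Submodule.Quotient.eq, mem_BF_iff]
    refine ⟨_, neg_mem hh, ?_⟩
    rw [Submodule.coe_sub, map_sub, hf, hy, map_neg]
    abel

theorem HL_union {m : ℕ} (M : Set (Finset (Fin m))) (J : Finset (Fin m)) (q : ℤ)
    (T : Finset (Finset (Fin m))) :
    (∀ σ ∈ T, σ ∈ M ∨ ∃ τ ∈ M, τ ⊂ σ) →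
      Nonempty (HL k M J q ≃ₗ[k] HL k (M ∪ ↑T) J q) := by
  induction T using Finset.induction_on with
  | empty =>
    intro _
    rw [Finset.coe_empty, Set.union_empty]
    exact ⟨LinearEquiv.refl _ _⟩
  | insert σ T hσ ih =>
    intro h
    obtain ⟨e⟩ := ih fun s hs => h s (Finset.mem_insert_of_mem hs)
    rw [Finset.coe_insert, Set.union_insert]
    by_cases hm : σ ∈ M ∪ ↑T
    · rw [Set.insert_eq_of_mem hm]; exact ⟨e⟩
    · rcases h σ (Finset.mem_insert_self _ _) with h | ⟨τ, hτ, hs⟩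
      · exact absurd (Or.inl h) hm
      · obtain ⟨e'⟩ := HL_step k (M ∪ ↑T) J q (Or.inl hτ) hs hm
        exact ⟨e.trans e'⟩

theorem exists_missing {m : ℕ} (K : Set (Finset (Fin m))) (σ : Finset (Fin m)) :
    σ ∉ K → ∃ τ, MissingFace K τ ∧ τ ⊆ σ := by
  induction σ using Finset.strongInduction with
  | H σ ih =>
    intro h
    by_cases hm : ∀ s, s ⊂ σ → s ∈ K
    · exact ⟨σ, ⟨h, hm⟩, subset_rfl⟩
    · push Not at hm
      obtain ⟨s, hs, hsK⟩ := hm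
      obtain ⟨τ, h1, h2⟩ := ih s hs hsK
      exact ⟨τ, h1, h2.trans hs.1⟩

theorem HL_missing {m : ℕ} (K P : Set (Finset (Fin m)))
    (hP : IsSimplicialComplement K P) (J : Finset (Fin m)) (q : ℤ) :
    Nonempty (HL k {τ | MissingFace K τ} J q ≃ₗ[k] HL k P J q) := by
  have h := HL_union k {τ | MissingFace K τ} J q P.toFinset (fun σ hσ => by
    obtain ⟨τ, h1, h2⟩ := exists_missing K σ (hP.1 σ (Set.mem_toFinset.mp hσ))
    rcases h2.eq_or_ssubset with rfl | h3
    · exact Or.inl h1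
    · exact Or.inr ⟨τ, h1, h3⟩)
  have hsub : {τ | MissingFace K τ} ⊆ P := hP.2
  rwa [Set.coe_toFinset, Set.union_eq_self_of_subset_left hsub] at h

/-- independence of the simplicial complement; `k` a field or `ℤ`. For any
two simplicial complements `P`, `P'` of a simplicial complex `K` on `[m]`,
`H_i(Λ^{*,J}[P], d) ≅ H_i(Λ^{*,J}[P'], d)` for every `i` and every `J ⊆ [m]`. -/
theorem HL_independent_of_complement {m : ℕ} (hk : IsField k ∨ Nonempty (k ≃+* ℤ))
    (K P P' : Set (Finset (Fin m))) (hK : IsComplex K)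
    (hP : IsSimplicialComplement K P) (hP' : IsSimplicialComplement K P') :
    ∀ (i : ℕ) (J : Finset (Fin m)),
      Nonempty (HL k P J (i : ℤ) ≃ₗ[k] HL k P' J (i : ℤ)) := by
  intro i J
  obtain ⟨e⟩ := HL_missing k K P hP J i
  obtain ⟨e'⟩ := HL_missing k K P' hP' J i
  exact ⟨e.symm.trans e'⟩
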